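/- arXiv:2102.06028 — 2 statements merged into one kernel-verified Lean document; each statement's English description precedes it below -/
import Mathlib

section
/- In the attacked TCP system G_a with channels (Peer A and Peer B without timeout, four channels, and the attacked network), the string listen_A · listen_B belongs to L(G_a), both of its events are outside the attacker's controllable set ATTK, and no event σ satisfies listen_A · listen_B · σ ∈ L(G_a) (the reached global state is a deadlock); the reached state has Peer B at 'listen', not 'established'. Consequently, letting M_TM1 = { s ∈ L(G_a) : the state reached after s has A = closed and B = established }, every sublanguage K ⊆ M_TM1 that is controllable with respect to (L(G_a), Σ \ ATTK) is empty, so no For-all attack against Threat Model 1 exists in this setup. -/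
/-! Model of TCP connection establishment with channels: Peer A, Peer B, four channels
C1–C4, and the attacked network, composed synchronously. -/

/-- Packet types. -/
inductive Pkt | syn | ack | fin | synack deriving DecidableEq

/-- Events: `ac1 m` = packet `m` from Peer A to Channel 1, `c1n m` = from Channel 1 to
the network, `nc2 m` = from the network to Channel 2, `c2a m` = from Channel 2 to
Peer A; similarly `bc3`, `c3n`, `nc4`, `c4b` on Peer B's side; plus private events. -/
inductive Ev
  | ac1 : Pkt → Ev
  | c1n : Pkt → Ev
  | nc2 : Pkt → Ev
  | c2a : Pkt → Ev
  | bc3 : Pkt → Ev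
  | c3n : Pkt → Ev
  | nc4 : Pkt → Ev
  | c4b : Pkt → Ev
  | listenA | listenB | delA | delB
  deriving DecidableEq

/-- TCP peer states. -/
inductive PSt
  | closed | synsent | listen | i0 | i1 | i2 | established | synreceived | i3
  | closewait | lastack | finwait1 | finwait2 | i4 | i5 | closing | timewait
  deriving DecidableEq

/-- TCP peer transitions (without timeout), parametrized by the peer's send events
`snd`, receive events `rcv`, and private events `lst`, `del`. -/
def peerTrans (snd rcv : Pkt → Ev) (lst del : Ev) : List (PSt × Ev × PSt) :=
  [(.closed, snd .syn, .synsent), (.synsent, rcv .synack, .i0), (.i0, snd .ack, .established),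
   (.synsent, rcv .syn, .i1), (.i1, snd .ack, .synreceived),
   (.synreceived, rcv .ack, .established),
   (.closed, lst, .listen), (.listen, rcv .syn, .i2),
   (.i2, snd .synack, .synreceived),
   (.established, rcv .fin, .i3), (.i3, snd .ack, .closewait),
   (.closewait, snd .fin, .lastack), (.lastack, rcv .ack, .closed),
   (.established, snd .fin, .finwait1), (.finwait1, rcv .ack, .finwait2),
   (.finwait1, rcv .fin, .i4), (.finwait2, rcv .fin, .i5),
   (.i4, snd .ack, .closing), (.closing, rcv .ack, .closed),
   (.i5, snd .ack, .timewait), (.timewait, del, .closed)]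

/-- A peer's alphabet. -/
def peerAlph (snd rcv : Pkt → Ev) (lst del : Ev) (e : Ev) : Prop :=
  (∃ m, e = snd m) ∨ (∃ m, e = rcv m) ∨ e = lst ∨ e = del

/-- Peer A: sends `ac1 m`, receives `c2a m`. -/
def peerAStep (q : PSt) (e : Ev) (q' : PSt) : Prop :=
  (q, e, q') ∈ peerTrans Ev.ac1 Ev.c2a .listenA .delA
def peerAAlph : Ev → Prop := peerAlph Ev.ac1 Ev.c2a .listenA .delA

/-- Peer B: sends `bc3 m`, receives `c4b m`. -/
def peerBStep (q : PSt) (e : Ev) (q' : PSt) : Prop :=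
  (q, e, q') ∈ peerTrans Ev.bc3 Ev.c4b .listenB .delB
def peerBAlph : Ev → Prop := peerAlph Ev.bc3 Ev.c4b .listenB .delB

/-- One-place channel: state `none` (empty) or `some m` (holding packet `m`). -/
def chanStep (inp out : Pkt → Ev) (q : Option Pkt) (e : Ev) (q' : Option Pkt) : Prop :=
  (∃ m, q = none ∧ e = inp m ∧ q' = some m) ∨ (∃ m, q = some m ∧ e = out m ∧ q' = none)
def chanAlph (inp out : Pkt → Ev) (e : Ev) : Prop := (∃ m, e = inp m) ∨ (∃ m, e = out m)

/-- Network states: `init`, plus a state `qa m` / `qb m` per packet in transit. -/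
inductive NSt | init | qa : Pkt → NSt | qb : Pkt → NSt
  deriving DecidableEq

/-- The network alphabet. -/
def netAlph (e : Ev) : Prop :=
  (∃ m, e = Ev.c1n m) ∨ (∃ m, e = Ev.c3n m) ∨ (∃ m, e = Ev.nc2 m) ∨ (∃ m, e = Ev.nc4 m)

/-- The attacker's controllable events: the outgoing packets of the network. -/
def ATTK : Set Ev := {e | ∃ m, e = Ev.nc2 m ∨ e = Ev.nc4 m}

/-- Attacked network transitions: from any non-initial state the attacker may emit any
event of `ATTK`. -/
def netTransAtk (q : NSt) (e : Ev) (q' : NSt) : Prop :=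
  (∃ m, q = .init ∧ e = .c1n m ∧ q' = .qa m) ∨
  (∃ m, q = .init ∧ e = .c3n m ∧ q' = .qb m) ∨
  ((∃ m, q = .qa m ∨ q = .qb m) ∧ e ∈ ATTK ∧ q' = .init)

/-- Synchronization of one component: if the event is in the component's alphabet, the
component must execute a transition on it; otherwise the component does not move. -/
def sync {Q : Type*} (alph : Ev → Prop) (trans : Q → Ev → Q → Prop)
    (q : Q) (e : Ev) (q' : Q) : Prop :=
  (alph e ∧ trans q e q') ∨ (¬ alph e ∧ q' = q)

/-- Global states of the TCP system with channels. -/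
structure GSt where
  pa : PSt
  pb : PSt
  c1 : Option Pkt
  c2 : Option Pkt
  c3 : Option Pkt
  c4 : Option Pkt
  net : NSt
  deriving DecidableEq

/-- Global step of the synchronous composition `G_a` (attacked network). -/
def gstep (q : GSt) (e : Ev) (q' : GSt) : Prop :=
  sync peerAAlph peerAStep q.pa e q'.pa ∧
  sync peerBAlph peerBStep q.pb e q'.pb ∧
  sync (chanAlph Ev.ac1 Ev.c1n) (chanStep Ev.ac1 Ev.c1n) q.c1 e q'.c1 ∧
  sync (chanAlph Ev.nc2 Ev.c2a) (chanStep Ev.nc2 Ev.c2a) q.c2 e q'.c2 ∧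
  sync (chanAlph Ev.bc3 Ev.c3n) (chanStep Ev.bc3 Ev.c3n) q.c3 e q'.c3 ∧
  sync (chanAlph Ev.nc4 Ev.c4b) (chanStep Ev.nc4 Ev.c4b) q.c4 e q'.c4 ∧
  sync netAlph netTransAtk q.net e q'.net

/-- Runs of the composition. -/
inductive Reach (step : GSt → Ev → GSt → Prop) (q0 : GSt) : List Ev → GSt → Prop
  | nil : Reach step q0 [] q0
  | snoc {s : List Ev} {q : GSt} {e : Ev} {q' : GSt} :
      Reach step q0 s q → step q e q' → Reach step q0 (s ++ [e]) q'

/-- Initial global state. -/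
def init : GSt := ⟨.closed, .closed, none, none, none, none, .init⟩

/-- Generated language of `G_a`. -/
def Lang : Set (List Ev) := {s | ∃ q, Reach gstep init s q}

/-- Violation of Threat Model 1: strings after which Peer A is at `closed` while Peer B
is at `established`. -/
def MTM1 : Set (List Ev) :=
  {s | ∃ q : GSt, Reach gstep init s q ∧ q.pa = PSt.closed ∧ q.pb = PSt.established}

/-! Abstract supervisory-control notions on languages. -/

/-- Prefix closure `pr(K)`. -/
def prefixClosure {A : Type*} (K : Set (List A)) : Set (List A) := {s | ∃ t ∈ K, s <+: t}

/-- Controllability of `K` w.r.t. `(L, Auc)`. -/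
def IsControllable {A : Type*} (K L : Set (List A)) (Auc : Set A) : Prop :=
  ∀ s ∈ prefixClosure K, ∀ σ ∈ Auc, s ++ [σ] ∈ L → s ++ [σ] ∈ prefixClosure K

/-- Normality of `K` w.r.t. `(L, P)`: `pr(K) = P⁻¹(P(pr(K))) ∩ L`. -/
def IsNormalLang {A : Type*} (K L : Set (List A)) (P : List A → List A) : Prop :=
  prefixClosure K = {s | ∃ t ∈ prefixClosure K, P s = P t} ∩ L

theorem reach_nil_iff {step : GSt → Ev → GSt → Prop} {q0 q : GSt} :
    Reach step q0 [] q ↔ q = q0 := by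
  refine ⟨fun h => ?_, fun h => h ▸ .nil⟩
  generalize hs : ([] : List Ev) = s at h
  cases h with
  | nil => rfl
  | snoc _ _ => simp at hs

theorem reach_append_singleton_iff {step : GSt → Ev → GSt → Prop} {q0 q' : GSt}
    {s : List Ev} {e : Ev} :
    Reach step q0 (s ++ [e]) q' ↔ ∃ q, Reach step q0 s q ∧ step q e q' := by
  refine ⟨fun h => ?_, fun ⟨q, h, hq⟩ => .snoc h hq⟩
  generalize ht : s ++ [e] = t at h
  cases h with
  | nil => simp at ht
  | snoc h hq =>
    obtain ⟨rfl, rfl⟩ := List.append_singleton_inj.mp ht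
    exact ⟨_, h, hq⟩

theorem mem_Lang_of_prefix {s t : List Ev} (hst : s <+: t) (ht : t ∈ Lang) : s ∈ Lang := by
  obtain ⟨u, rfl⟩ := hst
  induction u using List.reverseRecOn with
  | nil => simpa using ht
  | append_singleton u e ih =>
    obtain ⟨q, hq⟩ := ht
    rw [← List.append_assoc, reach_append_singleton_iff] at hq
    obtain ⟨q', hq', -⟩ := hq
    exact ih ⟨q', hq'⟩

/-- The state reached from `init` after `listenA`. -/
def listenAState : GSt := ⟨.listen, .closed, none, none, none, none, .init⟩

/-- The state reached from `init` after `listenA` and `listenB`. -/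
def bothListenState : GSt := ⟨.listen, .listen, none, none, none, none, .init⟩

theorem gstep_init_listenA_iff {q : GSt} : gstep init .listenA q ↔ q = listenAState := by
  cases q
  simp [gstep, sync, peerAAlph, peerBAlph, peerAlph, peerAStep, peerTrans, chanAlph, netAlph,
    init, listenAState]

theorem gstep_listenAState_listenB_iff {q : GSt} :
    gstep listenAState .listenB q ↔ q = bothListenState := by
  cases q
  simp [gstep, sync, peerAAlph, peerBAlph, peerAlph, peerBStep, peerTrans, chanAlph, netAlph,
    listenAState, bothListenState]

theorem reach_listenA_listenB_iff {q : GSt} :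
    Reach gstep init [.listenA, .listenB] q ↔ q = bothListenState := by
  rw [← List.singleton_append, reach_append_singleton_iff, ← List.nil_append [Ev.listenA]]
  simp only [reach_append_singleton_iff, reach_nil_iff, exists_eq_left, gstep_init_listenA_iff,
    gstep_listenAState_listenB_iff]

theorem not_gstep_bothListenState (e : Ev) (q : GSt) : ¬ gstep bothListenState e q := by
  rintro ⟨hA, hB, h1, h2, h3, h4, hN⟩
  cases e <;>
    simp [sync, peerAAlph, peerBAlph, peerAlph, peerAStep, peerBStep, peerTrans, chanAlph,
      chanStep, netAlph, netTransAtk, bothListenState] at hA hB h1 h2 h3 h4 hN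

theorem listenA_listenB_mem_Lang : [.listenA, .listenB] ∈ Lang :=
  ⟨_, reach_listenA_listenB_iff.mpr rfl⟩

theorem listenA_listenB_append_notMem_Lang (e : Ev) : [.listenA, .listenB] ++ [e] ∉ Lang := by
  rintro ⟨q, hq⟩
  obtain ⟨q', hq', hstep⟩ := reach_append_singleton_iff.mp hq
  rw [reach_listenA_listenB_iff] at hq'
  exact not_gstep_bothListenState e q (hq' ▸ hstep)

theorem eq_of_listenA_listenB_prefix {t : List Ev} (ht : t ∈ Lang)
    (h : [.listenA, .listenB] <+: t) : t = [.listenA, .listenB] := by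
  obtain ⟨u, rfl⟩ := h
  cases u with
  | nil => rfl
  | cons e u =>
    refine absurd (mem_Lang_of_prefix ?_ ht) (listenA_listenB_append_notMem_Lang e)
    exact ⟨u, by simp⟩

theorem IsControllable.append_mem_prefixClosure {A : Type*} {K L : Set (List A)} {Auc : Set A}
    (hK : IsControllable K L Auc) (hL : ∀ s t : List A, s <+: t → t ∈ L → s ∈ L)
    {s u : List A} (hs : s ∈ prefixClosure K) (hu : ∀ a ∈ u, a ∈ Auc) (hsu : s ++ u ∈ L) :
    s ++ u ∈ prefixClosure K := by
  induction u using List.reverseRecOn with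
  | nil => simpa using hs
  | append_singleton u a ih =>
    rw [← List.append_assoc] at hsu ⊢
    exact hK _ (ih (fun b hb => hu b (by simp [hb])) (hL _ _ (List.prefix_append _ _) hsu)) a
      (hu a (by simp)) hsu

/-- the string `listen_A · listen_B` belongs to `L(G_a)`, both its
events are uncontrollable for the attacker (outside `ATTK`), and the reached global
state is a deadlock, with Peer B at `listen` (not `established`).  Consequently every
sublanguage of `M_TM1` that is controllable w.r.t. `(L(G_a), Σ \ ATTK)` is empty: no
For-all attack against Threat Model 1 exists in this setup. -/
theorem stmt12 :
    ([.listenA, .listenB] : List Ev) ∈ Lang ∧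
    (Ev.listenA ∉ ATTK ∧ Ev.listenB ∉ ATTK) ∧
    (∀ e : Ev, ([.listenA, .listenB] : List Ev) ++ [e] ∉ Lang) ∧
    (∀ q : GSt, Reach gstep init [.listenA, .listenB] q →
      q.pb = PSt.listen ∧ q.pb ≠ PSt.established) ∧
    (∀ K ⊆ MTM1, IsControllable K Lang ATTKᶜ → K = ∅) := by
  have hA : Ev.listenA ∉ ATTK := by simp [ATTK]
  have hB : Ev.listenB ∉ ATTK := by simp [ATTK]
  refine ⟨listenA_listenB_mem_Lang, ⟨hA, hB⟩, listenA_listenB_append_notMem_Lang,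
    fun q hq => ?_, fun K hKM hK => ?_⟩
  · obtain rfl := reach_listenA_listenB_iff.mp hq
    exact ⟨rfl, PSt.noConfusion⟩
  · rw [Set.eq_empty_iff_forall_notMem]
    intro t ht
    obtain ⟨t', ht', hpre⟩ := hK.append_mem_prefixClosure (u := [.listenA, .listenB])
      (fun _ _ => mem_Lang_of_prefix) ⟨t, ht, List.nil_prefix⟩ (by simp [hA, hB])
      listenA_listenB_mem_Lang
    obtain ⟨q, hq, -, hqB⟩ := hKM ht'
    rw [eq_of_listenA_listenB_prefix ⟨q, hq⟩ hpre, reach_listenA_listenB_iff] at hq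
    subst hq
    exact PSt.noConfusion hqB
end

section
/- In the attacked TCP system G_a with channels (Peer A and Peer B without timeout, four channels, and the attacked network), the string SYN_BC3 · SYN_C3N · SYN_ACK_NC4 · SYN_ACK_C4B · ACK_BC3 belongs to L(G_a), and the global state reached after it has Peer A at 'closed' and Peer B at 'established'. Hence the set M_TM1 = { s ∈ L(G_a) : the state reached after s has A = closed and B = established } is nonempty, i.e., a There-exists attack against Threat Model 1 exists. -/
attribute [local simp] gstep sync peerAAlph peerBAlph peerAlph peerAStep peerBStep peerTrans
  chanAlph chanStep netAlph netTransAtk ATTK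

theorem gstep_init_bc3_syn {q : GSt} :
    gstep init (.bc3 .syn) q ↔ q = ⟨.closed, .synsent, none, none, some .syn, none, .init⟩ := by
  cases q
  simp [init]

theorem gstep_c3n_syn {pa pb : PSt} {c1 c2 c4 : Option Pkt} {q : GSt} :
    gstep ⟨pa, pb, c1, c2, some .syn, c4, .init⟩ (.c3n .syn) q ↔
      q = ⟨pa, pb, c1, c2, none, c4, .qb .syn⟩ := by
  cases q
  simp

theorem gstep_nc4 {pa pb : PSt} {c1 c2 c3 : Option Pkt} {m m' : Pkt} {q : GSt} :
    gstep ⟨pa, pb, c1, c2, c3, none, .qb m⟩ (.nc4 m') q ↔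
      q = ⟨pa, pb, c1, c2, c3, some m', .init⟩ := by
  cases q
  simp

theorem gstep_c4b_synack {pa : PSt} {c1 c2 c3 : Option Pkt} {n : NSt} {q : GSt} :
    gstep ⟨pa, .synsent, c1, c2, c3, some .synack, n⟩ (.c4b .synack) q ↔
      q = ⟨pa, .i0, c1, c2, c3, none, n⟩ := by
  cases q
  simp

theorem gstep_bc3_ack {pa : PSt} {c1 c2 c4 : Option Pkt} {n : NSt} {q : GSt} :
    gstep ⟨pa, .i0, c1, c2, none, c4, n⟩ (.bc3 .ack) q ↔
      q = ⟨pa, .established, c1, c2, some .ack, c4, n⟩ := by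
  cases q
  simp

theorem reach_attack_iff {q : GSt} :
    Reach gstep init [.bc3 .syn, .c3n .syn, .nc4 .synack, .c4b .synack, .bc3 .ack] q ↔
      q = ⟨.closed, .established, none, none, some .ack, none, .init⟩ := by
  rw [show ([.bc3 .syn, .c3n .syn, .nc4 .synack, .c4b .synack, .bc3 .ack] : List Ev) =
    ((((([] ++ [.bc3 .syn]) ++ [.c3n .syn]) ++ [.nc4 .synack]) ++ [.c4b .synack]) ++
      [.bc3 .ack]) from rfl]
  simp only [reach_append_singleton_iff, reach_nil_iff, exists_eq_left, gstep_init_bc3_syn,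
    gstep_c3n_syn, gstep_nc4, gstep_c4b_synack, gstep_bc3_ack]

/-- the string `SYN_BC3 · SYN_C3N · SYN_ACK_NC4 · SYN_ACK_C4B · ACK_BC3`
belongs to `L(G_a)` and leads to a global state with Peer A at `closed` and Peer B at
`established`; hence `M_TM1 ≠ ∅`, i.e. a There-exists attack against Threat Model 1
exists. -/
theorem stmt13 :
    ([.bc3 .syn, .c3n .syn, .nc4 .synack, .c4b .synack, .bc3 .ack] : List Ev) ∈ Lang ∧
    (∀ q : GSt,
      Reach gstep init [.bc3 .syn, .c3n .syn, .nc4 .synack, .c4b .synack, .bc3 .ack] q →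
      q.pa = PSt.closed ∧ q.pb = PSt.established) ∧
    MTM1.Nonempty := by
  refine ⟨⟨_, reach_attack_iff.2 rfl⟩, fun q hq => ?_, ⟨_, _, reach_attack_iff.2 rfl, rfl, rfl⟩⟩
  obtain rfl := reach_attack_iff.1 hq
  exact ⟨rfl, rfl⟩
end
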